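/- arXiv:1002.0053 — 2 statements merged into one kernel-verified Lean document; each statement's English description precedes it below -/
import Mathlib

section
/- Let R be a unital ℂ-algebra and let τ : R → ℂ be a trace, i.e. a ℂ-linear map with τ(xy) = τ(yx) for all x, y ∈ R. Let m ≥ 2 be an even integer, let F, G ∈ R satisfy F² = 1 and G² = 1, and let x₀, x₁, …, x_{m−1} ∈ R. Writing [G,x] = Gx − xG, one has τ( x₀·[G,x₁]⋯[G,x_{m−1}] + F·x₀·[G,x₁]⋯[G,x_{m−1}]·F ) = τ( G·[G,x₀]·[G,x₁]⋯[G,x_{m−1}] ). -/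
theorem anticomm_prod_aux {R : Type*} [Ring R] (G : R) (hG : G * G = 1) (x : ℕ → R) (n : ℕ) :
    G * ((List.range n).map (fun i => G * x (i + 1) - x (i + 1) * G)).prod
      = (-1) ^ n * (((List.range n).map (fun i => G * x (i + 1) - x (i + 1) * G)).prod * G) := by
  induction n with
  | zero => simp
  | succ n ih =>
    rw [List.range_succ, List.map_append, List.prod_append, List.map_singleton,
      List.prod_singleton, ← mul_assoc, ih]
    have h : G * (G * x (n + 1) - x (n + 1) * G) = -((G * x (n + 1) - x (n + 1) * G) * G) := by
      rw [mul_sub, sub_mul, ← mul_assoc, hG, mul_assoc (x (n + 1)), hG]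
      simp [mul_assoc]
    rw [mul_assoc, mul_assoc _ G, h, pow_succ]
    simp [mul_assoc]

/-- Trace identity for the index cocycle of a perturbed symmetry in the
odd-dimensional (ungraded, `m` even) case:
`τ(x₀[G,x₁]⋯[G,x_{m-1}] + F x₀ [G,x₁]⋯[G,x_{m-1}] F) = τ(G[G,x₀][G,x₁]⋯[G,x_{m-1}])`. -/
theorem trace_identity_ungraded {R : Type*} [Ring R] [Algebra ℂ R]
    (τ : R →ₗ[ℂ] ℂ) (htr : ∀ x y : R, τ (x * y) = τ (y * x))
    (m : ℕ) (hm : 2 ≤ m) (hme : Even m)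
    (F G : R) (hF : F ^ 2 = 1) (hG : G ^ 2 = 1) (x : ℕ → R) :
    τ (x 0 * ((List.range (m - 1)).map (fun i => G * x (i + 1) - x (i + 1) * G)).prod
        + F * x 0 * ((List.range (m - 1)).map (fun i => G * x (i + 1) - x (i + 1) * G)).prod * F)
      = τ (G * (G * x 0 - x 0 * G)
          * ((List.range (m - 1)).map (fun i => G * x (i + 1) - x (i + 1) * G)).prod) := by
  have hF2 : F * F = 1 := by rw [← pow_two, hF]
  have hG2 : G * G = 1 := by rw [← pow_two, hG]
  have hP := anticomm_prod_aux G hG2 x (m - 1)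
  have hodd : Odd (m - 1) := Nat.Even.sub_odd (by omega) hme odd_one
  rw [hodd.neg_one_pow] at hP
  generalize ((List.range (m - 1)).map (fun i => G * x (i + 1) - x (i + 1) * G)).prod = P at *
  have e1 : τ (F * x 0 * P * F) = τ (x 0 * P) := by
    rw [htr]
    simp only [← mul_assoc, hF2, one_mul]
  have e2 : G * (G * x 0 - x 0 * G) * P = x 0 * P + G * (x 0 * P * G) := by
    have : G * (G * x 0 - x 0 * G) * P = (G * G) * x 0 * P - G * x 0 * (G * P) := by
      noncomm_ring
    rw [this, hP, hG2]
    noncomm_ring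
  have e3 : τ (G * (x 0 * P * G)) = τ (x 0 * P) := by
    rw [htr, mul_assoc, hG2, mul_one]
  rw [e2, map_add, map_add, e1, e3]
end

section
/- Let A and R be unital ℂ-algebras, let π : A → R be a unital algebra homomorphism, and let τ : R → ℂ be a trace, i.e. a ℂ-linear map with τ(xy) = τ(yx) for all x, y ∈ R. Let m ≥ 1 and let F, G ∈ R satisfy F² = 1 and G² = 1. If m is odd, assume additionally that there is γ ∈ R with γ² = 1, γ·π(a) = π(a)·γ for all a ∈ A, γF = −Fγ and γG = −Gγ; if m is even set γ = 1. Define the (m−1)-cochains τ_F, τ_G ∈ C^{m−1}(A) by τ_F(a₀,…,a_{m−1}) = ½·τ( γ·F·[F,π(a₀)]⋯[F,π(a_{m−1})] ) and τ_G(a₀,…,a_{m−1}) = ½·τ( γ·G·[G,π(a₀)]⋯[G,π(a_{m−1})] ), where [F,x] = Fx − xF. Then there exists ψ = (ψ^{m−2}, ψ^{m−4}, …) ∈ 𝓑^{m−2}(A) with (b+B)ψ = (τ_G − τ_F, 0, 0, …) in 𝓑^{m−1}(A); in particular τ_F and τ_G define the same class in the cohomology of the total complex (𝓑^*(A), b+B).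 -/
noncomputable section

/-- A functional `φ : Aᵏ → ℂ` is ℂ-multilinear. -/
def IsMultilin {A : Type*} [Ring A] [Module ℂ A] {k : ℕ} (φ : (Fin k → A) → ℂ) : Prop :=
  ∀ (i : Fin k) (a : Fin k → A) (x y : A) (c : ℂ),
    φ (Function.update a i (x + y))
        = φ (Function.update a i x) + φ (Function.update a i y) ∧
    φ (Function.update a i (c • x)) = c * φ (Function.update a i x)

/-- The Hochschild coboundary `b : Cⁿ(A) → Cⁿ⁺¹(A)` (a cochain of degree `n` is a
functional of `n+1` variables). -/
def bOp {A : Type*} [Ring A] (n : ℕ) (φ : (Fin (n + 1) → A) → ℂ) :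
    (Fin (n + 2) → A) → ℂ := fun a =>
  (∑ i : Fin (n + 1), (-1 : ℂ) ^ (i : ℕ) *
      φ fun j => if j.1 < i.1 then a j.castSucc
        else if j.1 = i.1 then a j.castSucc * a j.succ
        else a j.succ)
  + (-1 : ℂ) ^ (n + 1) *
      φ fun j => if j.1 = 0 then a (Fin.last (n + 1)) * a 0 else a j.castSucc

/-- The Connes coboundary `B = N ∘ B₀ : Cⁿ⁺¹(A) → Cⁿ(A)`. -/
def BOp {A : Type*} [Ring A] (n : ℕ) (φ : (Fin (n + 2) → A) → ℂ) :
    (Fin (n + 1) → A) → ℂ := fun a =>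
  ∑ j : Fin (n + 1), (-1 : ℂ) ^ (n * j.1) *
    (φ (Fin.cons 1 fun i : Fin (n + 1) =>
          a ⟨(i.1 + j.1) % (n + 1), Nat.mod_lt _ (Nat.succ_pos n)⟩)
     - (-1 : ℂ) ^ (n + 1) *
       φ (Fin.snoc (fun i : Fin (n + 1) =>
            a ⟨(i.1 + j.1) % (n + 1), Nat.mod_lt _ (Nat.succ_pos n)⟩) 1))

/-- The index cocycle `τ_F(a₀,…,a_{m−1}) = ½ τ(γ F [F,π(a₀)] ⋯ [F,π(a_{m−1})])` of a
symmetry `F`, relative to a trace `τ`, a grading `γ` and a homomorphism `π`. -/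
def indexCocycle {A R : Type*} [Ring A] [Algebra ℂ A] [Ring R] [Algebra ℂ R]
    (π : A →ₐ[ℂ] R) (τ : R →ₗ[ℂ] ℂ) (γ F : R) (m : ℕ) :
    (Fin m → A) → ℂ := fun a =>
  (2⁻¹ : ℂ) * τ (γ * F * (List.ofFn fun i : Fin m => F * π (a i) - π (a i) * F).prod)

def cdd {A R : Type*} [Ring A] [Algebra ℂ A] [Ring R] [Algebra ℂ R]
    (π : A →ₐ[ℂ] R) (F : R) (x : A) : R := F * π x - π x * F

def cQ {A R : Type*} [Ring A] [Algebra ℂ A] [Ring R] [Algebra ℂ R]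
    (π : A →ₐ[ℂ] R) (F : R) (f : ℕ → A) : ℕ → R
  | 0 => 1
  | k + 1 => cQ π F f k * cdd π F (f k)

def cP {A R : Type*} [Ring A] [Algebra ℂ A] [Ring R] [Algebra ℂ R]
    (π : A →ₐ[ℂ] R) (F : R) (f : ℕ → A) (k : ℕ) : R :=
  π (f 0) * cQ π F (fun i => f (i + 1)) k

def cext {A : Type*} {n : ℕ} (a : Fin (n + 1) → A) (j : ℕ) : A :=
  a ⟨j % (n + 1), Nat.mod_lt _ (Nat.succ_pos n)⟩

def cmu {A : Type*} [Ring A] (i : ℕ) (f : ℕ → A) (j : ℕ) : A :=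
  if j < i then f j else if j = i then f j * f (j + 1) else f (j + 1)

def comega {A R : Type*} [Ring A] [Algebra ℂ A] [Ring R] [Algebra ℂ R]
    (π : A →ₐ[ℂ] R) (τ : R →ₗ[ℂ] ℂ) (γ F : R) (n : ℕ) (a : Fin (n + 1) → A) : ℂ :=
  τ (γ * F * cP π F (cext a) n)

section helpers
variable {A R : Type*} [Ring A] [Algebra ℂ A] [Ring R] [Algebra ℂ R]
    (π : A →ₐ[ℂ] R) (τ : R →ₗ[ℂ] ℂ) (γ F : R)

theorem cdd_mul (x y : A) : cdd π F (x * y) = cdd π F x * π y + π x * cdd π F y := by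
  simp only [cdd, map_mul]; noncomm_ring

theorem cdd_one : cdd π F 1 = 0 := by simp [cdd]

theorem cdd_add (x y : A) : cdd π F (x + y) = cdd π F x + cdd π F y := by
  simp only [cdd, map_add]; noncomm_ring

theorem cdd_smul (c : ℂ) (x : A) : cdd π F (c • x) = c • cdd π F x := by
  simp [cdd, smul_sub]

theorem F_cdd (hF : F * F = 1) (x : A) : F * cdd π F x = -(cdd π F x * F) := by
  have h1 : F * (F * π x) = π x := by rw [← mul_assoc, hF, one_mul]
  have h2 : π x * F * F = π x := by rw [mul_assoc, hF, mul_one]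
  simp only [cdd, mul_sub, sub_mul, h1, h2, mul_assoc]
  simp

theorem g_cdd (s : ℂ) (hg : ∀ x, γ * π x = π x * γ) (hs : γ * F = s • (F * γ)) (x : A) :
    γ * cdd π F x = s • (cdd π F x * γ) := by
  simp only [cdd, mul_sub, sub_mul, smul_sub]
  congr 1
  · rw [← mul_assoc, hs, smul_mul_assoc, mul_assoc, hg, mul_assoc]
  · rw [← mul_assoc, hg, mul_assoc, hs, mul_smul_comm, mul_assoc]

theorem cQ_congr {f g : ℕ → A} (k : ℕ) (h : ∀ i < k, f i = g i) : cQ π F f k = cQ π F g k := by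
  induction k with
  | zero => rfl
  | succ k ih =>
    simp only [cQ]
    rw [ih (fun i hi => h i (by omega)), h k (by omega)]

theorem cP_congr {f g : ℕ → A} (k : ℕ) (h : ∀ i ≤ k, f i = g i) : cP π F f k = cP π F g k := by
  simp only [cP]
  rw [h 0 (by omega), cQ_congr π F k (fun i hi => h (i + 1) (by omega))]

theorem cQ_succ' (f : ℕ → A) (k : ℕ) :
    cQ π F f (k + 1) = cdd π F (f 0) * cQ π F (fun i => f (i + 1)) k := by
  induction k with
  | zero => simp [cQ]
  | succ k ih => rw [cQ, ih, cQ, mul_assoc]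

theorem cP_succ (f : ℕ → A) (k : ℕ) :
    cP π F f (k + 1) = cP π F f k * cdd π F (f (k + 1)) := by
  simp only [cP, cQ, mul_assoc]

theorem cQ_ofFn (f : ℕ → A) (k : ℕ) :
    (List.ofFn fun i : Fin k => F * π (f i) - π (f i) * F).prod = cQ π F f k := by
  induction k generalizing f with
  | zero => simp [cQ]
  | succ k ih =>
    rw [List.ofFn_succ, List.prod_cons, cQ_succ', ← ih]
    rfl

theorem F_cQ (hF : F * F = 1) (f : ℕ → A) (k : ℕ) :
    F * cQ π F f k = (-1 : ℂ) ^ k • (cQ π F f k * F) := by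
  induction k with
  | zero => simp [cQ]
  | succ k ih =>
    rw [cQ, ← mul_assoc, ih, smul_mul_assoc, mul_assoc, F_cdd π F hF, pow_succ]
    simp [mul_assoc]

theorem cP_add (f : ℕ → A) (n k : ℕ) (hk : k ≤ n) (x y : A) :
    cP π F (Function.update f k (x + y)) n =
      cP π F (Function.update f k x) n + cP π F (Function.update f k y) n := by
  induction n with
  | zero =>
    obtain rfl : k = 0 := by omega
    simp [cP, cQ]
  | succ n ih =>
    simp only [cP_succ]
    rcases Nat.lt_or_ge n k with h | h
    · obtain rfl : k = n + 1 := by omega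
      have : ∀ z, cP π F (Function.update f (n + 1) z) n = cP π F f n := fun z =>
        cP_congr π F n (fun i hi => Function.update_of_ne (by omega) _ _)
      simp only [this, Function.update_self, cdd_add, mul_add]
    · have : ∀ z, Function.update f k z (n + 1) = f (n + 1) := fun z =>
        Function.update_of_ne (by omega) _ _
      simp only [this, ih h, add_mul]

theorem cP_smul (f : ℕ → A) (n k : ℕ) (hk : k ≤ n) (c : ℂ) (x : A) :
    cP π F (Function.update f k (c • x)) n = c • cP π F (Function.update f k x) n := by
  induction n with
  | zero =>
    obtain rfl : k = 0 := by omega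
    simp [cP, cQ]
  | succ n ih =>
    simp only [cP_succ]
    rcases Nat.lt_or_ge n k with h | h
    · obtain rfl : k = n + 1 := by omega
      have : ∀ z, cP π F (Function.update f (n + 1) z) n = cP π F f n := fun z =>
        cP_congr π F n (fun i hi => Function.update_of_ne (by omega) _ _)
      simp only [this, Function.update_self, cdd_smul, mul_smul_comm]
    · have : ∀ z, Function.update f k z (n + 1) = f (n + 1) := fun z =>
        Function.update_of_ne (by omega) _ _
      simp only [this, ih h, smul_mul_assoc]

theorem cext_of_lt {n : ℕ} (a : Fin (n + 1) → A) (j : ℕ) (hj : j < n + 1) :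
    cext a j = a ⟨j, hj⟩ := by
  simp [cext, Nat.mod_eq_of_lt hj]

theorem comega_multilin (n : ℕ) : IsMultilin (comega π τ γ F n) := by
  intro i a x y c
  have key : ∀ z, cP π F (cext (Function.update a i z)) n =
      cP π F (Function.update (cext a) i.1 z) n := by
    intro z
    apply cP_congr
    intro j hj
    rw [cext_of_lt _ j (by omega)]
    by_cases h : j = i.1
    · subst h; simp
    · rw [Function.update_of_ne h, cext_of_lt _ j (by omega), Function.update_of_ne]
      intro h'; apply h; rw [← h']
  have hi : i.1 ≤ n := by omega
  simp only [comega, key, cP_add π F _ n i.1 hi, cP_smul π F _ n i.1 hi, mul_add, map_add,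
    mul_smul_comm, map_smul, smul_eq_mul, and_self]

theorem telescope (f : ℕ → A) (n : ℕ) :
    ∑ i ∈ Finset.range (n + 1), (-1 : ℂ) ^ i • cP π F (cmu i f) n =
      (-1 : ℂ) ^ n • (cP π F f n * π (f (n + 1))) := by
  induction n with
  | zero => simp [cP, cQ, cmu]
  | succ n ih =>
    rw [Finset.sum_range_succ]
    have h1 : ∀ i ∈ Finset.range (n + 1), (-1 : ℂ) ^ i • cP π F (cmu i f) (n + 1) =
        ((-1 : ℂ) ^ i • cP π F (cmu i f) n) * cdd π F (f (n + 2)) := by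
      intro i hi
      have hi := Finset.mem_range.1 hi
      rw [cP_succ, smul_mul_assoc]
      have : cmu i f (n + 1) = f (n + 2) := by
        simp only [cmu]; rw [if_neg (by omega), if_neg (by omega)]
      rw [this]
    rw [Finset.sum_congr rfl h1, ← Finset.sum_mul, ih, cP_succ]
    have h2 : cP π F (cmu (n + 1) f) n = cP π F f n :=
      cP_congr π F n (fun i hi => by simp only [cmu]; rw [if_pos (by omega)])
    have h3 : cmu (n + 1) f (n + 1) = f (n + 1) * f (n + 2) := by simp [cmu]
    rw [h2, h3, cdd_mul, cP_succ, pow_succ]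
    simp only [mul_add, smul_mul_assoc, mul_neg, mul_one, neg_smul, smul_add, mul_assoc]
    abel

theorem b_comega (htr : ∀ x y : R, τ (x * y) = τ (y * x)) (s : ℂ)
    (hg : ∀ x, γ * π x = π x * γ) (hs : γ * F = s • (F * γ))
    (n : ℕ) (hsn : s = (-1) ^ n) (a : Fin (n + 2) → A) :
    bOp n (comega π τ γ F n) a = - τ (γ * cP π F (cext a) (n + 1)) := by
  set f : ℕ → A := cext a with hf
  have hfa : ∀ (j : ℕ) (h : j < n + 2), a ⟨j, h⟩ = f j := fun j h => (cext_of_lt a j h).symm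
  have e1 : ∀ i : Fin (n + 1), comega π τ γ F n (fun j => if j.1 < i.1 then a j.castSucc
        else if j.1 = i.1 then a j.castSucc * a j.succ else a j.succ) =
        τ (γ * F * cP π F (cmu i.1 f) n) := by
    intro i
    rw [comega]
    congr 2
    apply cP_congr
    intro j hj
    rw [cext_of_lt _ j (by omega)]
    simp only [cmu, ← hfa j (by omega), ← hfa (j + 1) (by omega)]
    rfl
  have e2 : comega π τ γ F n (fun j => if j.1 = 0 then a (Fin.last (n + 1)) * a 0
      else a j.castSucc) = τ (γ * F * (π (f (n + 1)) * cP π F f n)) := by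
    rw [comega]
    congr 2
    rw [cP, cP, ← mul_assoc, ← map_mul]
    congr 1
    · rw [cext_of_lt _ 0 (by omega), ← hfa 0 (by omega), ← hfa (n + 1) (by omega)]
      rfl
    · apply cQ_congr
      intro j hj
      rw [cext_of_lt _ (j + 1) (by omega), ← hfa (j + 1) (by omega)]
      simp
  have e3 : ∑ i : Fin (n + 1), (-1 : ℂ) ^ (i : ℕ) * τ (γ * F * cP π F (cmu i.1 f) n) =
      (-1 : ℂ) ^ n * τ (γ * F * (cP π F f n * π (f (n + 1)))) := by
    rw [Fin.sum_univ_eq_sum_range (fun i => (-1 : ℂ) ^ i * τ (γ * F * cP π F (cmu i f) n))]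
    have := congrArg (fun z => τ (γ * F * z)) (telescope π F f n)
    simpa [Finset.mul_sum] using this
  rw [bOp]
  simp only [e1, e2, e3]
  rw [cP_succ]
  generalize cP π F f n = X
  generalize f (n + 1) = p
  have h1 : τ (γ * F * (X * π p)) = τ (γ * (π p * F) * X) := by
    rw [← mul_assoc, htr, ← mul_assoc, ← mul_assoc, ← hg]; simp only [mul_assoc]
  have h2 : τ (γ * (X * cdd π F p)) = s * τ (γ * cdd π F p * X) := by
    rw [g_cdd π γ F s hg hs, ← mul_assoc, htr, smul_mul_assoc, map_smul, smul_eq_mul, ← mul_assoc,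
      ← mul_assoc, hsn, ← pow_add, ← two_mul, pow_mul]
    simp [mul_assoc]
  rw [h1, h2, cdd, hsn, mul_sub, sub_mul, map_sub, pow_succ]
  simp only [mul_assoc]
  ring

theorem FQ_eq (htr : ∀ x y : R, τ (x * y) = τ (y * x)) (hF : F * F = 1) (s : ℂ)
    (hs : γ * F = s • (F * γ))
    (k : ℕ) (hsk : s = (-1) ^ (k + 1)) (f : ℕ → A) :
    τ (γ * F * cQ π F f (k + 1)) = 2 * τ (γ * cP π F f k) := by
  rw [cQ_succ', cP]
  have hFQ := F_cQ π F hF (fun i => f (i + 1)) k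
  generalize cQ π F (fun i => f (i + 1)) k = Y at *
  generalize f 0 = p
  have h1 : γ * F * (cdd π F p * Y) = γ * (π p * Y) - γ * F * π p * (F * Y) := by
    have : γ * (π p * Y) = γ * (F * F) * (π p * Y) := by rw [hF, mul_one]
    rw [this, cdd]; noncomm_ring
  have hss : s * s = 1 := by rw [hsk, ← pow_add, ← two_mul, pow_mul]; simp
  have h2 : F * γ = s • (γ * F) := by rw [hs, smul_smul, hss, one_smul]
  have h3 : τ (γ * F * π p * (Y * F)) = s * τ (γ * (π p * Y)) := by
    rw [← mul_assoc, htr]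
    have : F * (γ * F * π p * Y) = s • (γ * (F * F) * (π p * Y)) := by
      simp only [← mul_assoc, h2, smul_mul_assoc]
    rw [this, hF]; simp
  rw [h1, hFQ, map_sub, mul_smul_comm, map_smul, h3, smul_eq_mul, ← mul_assoc ((-1 : ℂ) ^ k), hsk,
    ← pow_add]
  have : (-1 : ℂ) ^ (k + (k + 1)) = -1 := by
    rw [show k + (k + 1) = 2 * k + 1 by ring, pow_succ, pow_mul]; simp
  rw [this]; ring

theorem FQ_rot (htr : ∀ x y : R, τ (x * y) = τ (y * x)) (hF : F * F = 1) (s : ℂ)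
    (hg : ∀ x, γ * π x = π x * γ) (hs : γ * F = s • (F * γ))
    (k : ℕ) (hsk : s = (-1) ^ (k + 1)) (f : ℕ → A) (hf : f (k + 1) = f 0) :
    τ (γ * F * cQ π F (fun i => f (i + 1)) (k + 1)) =
      (-1) ^ k * τ (γ * F * cQ π F f (k + 1)) := by
  rw [cQ_succ' π F f, cQ, hf]
  generalize cQ π F (fun i => f (i + 1)) k = Y at *
  generalize f 0 = p
  have hss : s * s = 1 := by rw [hsk, ← pow_add, ← two_mul, pow_mul]; simp
  have hd : cdd π F p * γ = s • (γ * cdd π F p) := by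
    rw [g_cdd π γ F s hg hs, smul_smul, hss, one_smul]
  have h1 : cdd π F p * (γ * F * Y) = -(s • (γ * F * (cdd π F p * Y))) := by
    rw [← mul_assoc, ← mul_assoc, hd, smul_mul_assoc, smul_mul_assoc, mul_assoc γ,
      ← neg_eq_iff_eq_neg.2 (F_cdd π F hF p)]
    simp [mul_assoc]
  rw [← mul_assoc, htr, h1, map_neg, map_smul, hsk, smul_eq_mul, pow_succ]
  ring

theorem FQ_rots (htr : ∀ x y : R, τ (x * y) = τ (y * x)) (hF : F * F = 1) (s : ℂ)
    (hg : ∀ x, γ * π x = π x * γ) (hs : γ * F = s • (F * γ))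
    (k : ℕ) (hsk : s = (-1) ^ (k + 1)) (f : ℕ → A) (hf : ∀ i, f (i + (k + 1)) = f i) (j : ℕ) :
    τ (γ * F * cQ π F (fun i => f (i + j)) (k + 1)) =
      (-1) ^ (k * j) * τ (γ * F * cQ π F f (k + 1)) := by
  induction j with
  | zero => simp
  | succ j ih =>
    have := FQ_rot π τ γ F htr hF s hg hs k hsk (fun i => f (i + j))
      (by simp only [zero_add]; rw [← hf j]; congr 1; omega)
    rw [ih] at this
    have e : (fun i => f (i + (j + 1))) = fun i => f (i + 1 + j) := by
      funext i; congr 1; omega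
    rw [e, this, ← mul_assoc, ← pow_add]; congr 2; ring

theorem B_comega (htr : ∀ x y : R, τ (x * y) = τ (y * x)) (hF : F * F = 1) (s : ℂ)
    (hg : ∀ x, γ * π x = π x * γ) (hs : γ * F = s • (F * γ))
    (n : ℕ) (hsn : s = (-1) ^ (n + 1)) (a : Fin (n + 1) → A) :
    BOp n (comega π τ γ F (n + 1)) a = 2 * (n + 1) * τ (γ * cP π F (cext a) n) := by
  have e1 : ∀ j : Fin (n + 1), comega π τ γ F (n + 1) (Fin.cons 1 fun i : Fin (n + 1) =>
          a ⟨(i.1 + j.1) % (n + 1), Nat.mod_lt _ (Nat.succ_pos n)⟩) =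
        (-1) ^ (n * j.1) * τ (γ * F * cQ π F (cext a) (n + 1)) := by
    intro j
    rw [← FQ_rots π τ γ F htr hF s hg hs n hsn (cext a) (fun i => by simp [cext]), comega]
    congr 2
    rw [cP, cext_of_lt _ 0 (by omega)]
    have h0 : ∀ g : Fin (n + 1) → A,
      (Fin.cons 1 g : Fin (n + 2) → A) ⟨0, by omega⟩ = 1 := fun g => rfl
    rw [h0, map_one, one_mul]
    apply cQ_congr
    intro i hi
    rw [cext_of_lt _ (i + 1) (by omega)]
    rfl
  have e2 : ∀ g : Fin (n + 1) → A, comega π τ γ F (n + 1) (Fin.snoc g 1) = 0 := by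
    intro g
    have h0 : (Fin.snoc g 1 : Fin (n + 2) → A) ⟨n + 1, by omega⟩ = 1 :=
      Fin.snoc_last (α := fun _ => A) 1 g
    rw [comega, cP_succ, cext_of_lt _ (n + 1) (by omega), h0, cdd_one]
    simp
  rw [BOp]
  simp only [e1, e2, mul_zero, sub_zero]
  have : ∀ j : ℕ, (-1 : ℂ) ^ (n * j) * ((-1) ^ (n * j) *
      τ (γ * F * cQ π F (cext a) (n + 1))) = τ (γ * F * cQ π F (cext a) (n + 1)) := by
    intro j
    rw [← mul_assoc, ← pow_add, ← two_mul, pow_mul]; simp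
  simp only [this, Finset.sum_const, Finset.card_univ, Fintype.card_fin, nsmul_eq_mul]
  rw [FQ_eq π τ γ F htr hF s hs n hsn]
  push_cast; ring

theorem index_eq (htr : ∀ x y : R, τ (x * y) = τ (y * x)) (hF : F * F = 1) (s : ℂ)
    (hs : γ * F = s • (F * γ))
    (k : ℕ) (hsk : s = (-1) ^ (k + 1)) (a : Fin (k + 1) → A) :
    indexCocycle π τ γ F (k + 1) a = τ (γ * cP π F (cext a) k) := by
  have h := FQ_eq π τ γ F htr hF s hs k hsk (cext a)
  have h2 := cQ_ofFn π F (cext a) (k + 1)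
  have h3 : ∀ i : Fin (k + 1), cext a i.1 = a i := fun i => cext_of_lt a i.1 i.2
  simp only [h3] at h2
  rw [indexCocycle, h2, h]; ring

theorem bOp_comb (n : ℕ) (c : ℂ) (φ ψ : (Fin (n + 1) → A) → ℂ) (a : Fin (n + 2) → A) :
    bOp n (fun x => c * (φ x - ψ x)) a = c * (bOp n φ a - bOp n ψ a) := by
  simp only [bOp, mul_sub, Finset.sum_sub_distrib, mul_add, Finset.mul_sum, mul_left_comm c]
  ring

theorem BOp_comb (n : ℕ) (c : ℂ) (φ ψ : (Fin (n + 2) → A) → ℂ) (a : Fin (n + 1) → A) :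
    BOp n (fun x => c * (φ x - ψ x)) a = c * (BOp n φ a - BOp n ψ a) := by
  simp only [BOp, ← Finset.sum_sub_distrib, Finset.mul_sum]
  refine Finset.sum_congr rfl fun j _ => ?_
  ring

end helpers

def cdc : ℕ → ℂ
  | 0 => 1
  | 1 => 1
  | n + 2 => cdc n / (2 * (n + 2))

theorem cdc_ne : ∀ n, cdc n ≠ 0
  | 0 => by simp [cdc]
  | 1 => by simp [cdc]
  | n + 2 => by
    have := cdc_ne n
    have h : (n : ℂ) + 2 ≠ 0 := by exact_mod_cast Nat.succ_ne_zero (n + 1)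
    simp [cdc, this, h]

theorem cdc_rec (n : ℕ) : 2 * ((n : ℂ) + 2) * cdc (n + 2) = cdc n := by
  have h : (n : ℂ) + 2 ≠ 0 := by exact_mod_cast Nat.succ_ne_zero (n + 1)
  simp only [cdc]; field_simp

theorem sign_eq {m n : ℕ} (h : m % 2 = n % 2) : (-1 : ℂ) ^ m = (-1) ^ n := by
  rw [neg_one_pow_eq_pow_mod_two (n := m), h, ← neg_one_pow_eq_pow_mod_two]

/-- The index cocycles `τ_F` and `τ_G` of two symmetries `F, G` differ by the
`(b+B)`-coboundary of a cochain `ψ = (ψ^{m−2}, ψ^{m−4}, …) ∈ 𝓑^{m−2}(A)`; in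
particular they define the same cyclic cohomology class in `HC^{m−1}(A)`.

The family `ψ n` is the degree-`n` component (zero unless `n ≤ m−2` and `n ≡ m (mod 2)`),
and the equation `(b+B)ψ = (τ_G − τ_F, 0, 0, …)` is expressed componentwise: in degree
`n+1` it reads `B ψ^{n+2} + b ψ^n = (τ_G − τ_F if n+2 = m else 0)`, and in degree `0`
it reads `B ψ^1 = (τ_G − τ_F if m = 1 else 0)`. -/
theorem chern_character_perturbation_invariance
    {A R : Type*} [Ring A] [Algebra ℂ A] [Ring R] [Algebra ℂ R]
    (π : A →ₐ[ℂ] R) (τ : R →ₗ[ℂ] ℂ) (htr : ∀ x y : R, τ (x * y) = τ (y * x))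
    (m : ℕ) (hm : 1 ≤ m) (F G γ : R) (hF : F ^ 2 = 1) (hG : G ^ 2 = 1)
    (hγodd : Odd m → γ ^ 2 = 1 ∧ (∀ a : A, γ * π a = π a * γ) ∧
      γ * F = -(F * γ) ∧ γ * G = -(G * γ))
    (hγeven : Even m → γ = 1) :
    ∃ ψ : (n : ℕ) → ((Fin (n + 1) → A) → ℂ),
      (∀ n, IsMultilin (ψ n)) ∧
      (∀ n, ¬(n + 2 ≤ m ∧ (m - n) % 2 = 0) → ψ n = 0) ∧
      (∀ (n : ℕ) (a : Fin (n + 2) → A),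
        BOp (n + 1) (ψ (n + 2)) a + bOp n (ψ n) a
          = if h : n + 2 = m then
              (indexCocycle π τ γ G m - indexCocycle π τ γ F m)
                (fun i => a (Fin.cast h.symm i))
            else 0) ∧
      (∀ a : Fin 1 → A,
        BOp 0 (ψ 1) a
          = if h : m = 1 then
              (indexCocycle π τ γ G m - indexCocycle π τ γ F m)
                (fun i => a (Fin.cast h i))
            else 0) := by
  classical
  have hF' : F * F = 1 := by rw [← sq, hF]
  have hG' : G * G = 1 := by rw [← sq, hG]
  obtain ⟨hg, hsF, hsG⟩ : (∀ x, γ * π x = π x * γ) ∧ γ * F = ((-1 : ℂ) ^ m) • (F * γ) ∧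
      γ * G = ((-1 : ℂ) ^ m) • (G * γ) := by
    rcases Nat.even_or_odd m with h | h
    · rw [hγeven h, h.neg_one_pow]; simp
    · obtain ⟨-, h1, h2, h3⟩ := hγodd h
      rw [h.neg_one_pow]; simp [h1, h2, h3]
  let c : ℕ → ℂ := fun n =>
    if n + 2 ≤ m ∧ (m - n) % 2 = 0 then - cdc n / cdc (m - 2) else 0
  have hc0 : ∀ n, ¬(n + 2 ≤ m ∧ (m - n) % 2 = 0) → c n = 0 := fun n h => if_neg h
  have hc1 : ∀ n, (n + 2 ≤ m ∧ (m - n) % 2 = 0) → c n = - cdc n / cdc (m - 2) :=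
    fun n h => if_pos h
  refine ⟨fun n x => c n * (comega π τ γ G n x - comega π τ γ F n x), ?_, ?_, ?_, ?_⟩
  · intro n i a x y k
    have h1 := comega_multilin π τ γ F n i a x y k
    have h2 := comega_multilin π τ γ G n i a x y k
    constructor
    · simp only [h1.1, h2.1]; ring
    · simp only [h1.2, h2.2]; ring
  · intro n h
    funext x
    simp [hc0 n h]
  · intro n a
    rw [BOp_comb, bOp_comb]
    by_cases hp : n + 2 ≤ m ∧ (m - n) % 2 = 0
    · have hs1 : (-1 : ℂ) ^ m = (-1) ^ n := sign_eq (by omega)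
      have hs2 : (-1 : ℂ) ^ m = (-1) ^ (n + 1 + 1) := sign_eq (by omega)
      rw [b_comega π τ γ F htr _ hg hsF n hs1, b_comega π τ γ G htr _ hg hsG n hs1,
        B_comega π τ γ F htr hF' _ hg hsF (n + 1) hs2,
        B_comega π τ γ G htr hG' _ hg hsG (n + 1) hs2]
      by_cases hm2 : n + 2 = m
      · subst hm2
        rw [dif_pos rfl, hc0 (n + 2) (by omega), hc1 n hp, Pi.sub_apply]
        have hi : (fun i => a (Fin.cast rfl i)) = a := rfl
        rw [hi, index_eq π τ γ F htr hF' _ hsF (n + 1) hs2,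
          index_eq π τ γ G htr hG' _ hsG (n + 1) hs2]
        have := cdc_ne n
        simp only [Nat.add_sub_cancel]
        field_simp
        ring
      · rw [dif_neg hm2, hc1 n hp, hc1 (n + 2) (by omega), ← cdc_rec n]
        push_cast
        ring
    · have hp2 : ¬ (n + 2 + 2 ≤ m ∧ (m - (n + 2)) % 2 = 0) := by omega
      rw [hc0 n hp, hc0 (n + 2) hp2, dif_neg (by omega)]
      ring
  · intro a
    rw [BOp_comb]
    by_cases hm1 : m = 1
    · subst hm1
      rw [dif_pos rfl, hc0 1 (by omega), Pi.sub_apply]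
      have hi : (fun i => a (Fin.cast rfl i)) = a := rfl
      rw [hi, index_eq π τ γ F htr hF' _ hsF 0 rfl, index_eq π τ γ G htr hG' _ hsG 0 rfl]
      simp [cP, cQ]
    · rw [dif_neg hm1]
      by_cases hp : 1 + 2 ≤ m ∧ (m - 1) % 2 = 0
      · have hs : (-1 : ℂ) ^ m = (-1) ^ (0 + 1) := sign_eq (by omega)
        rw [B_comega π τ γ F htr hF' _ hg hsF 0 hs, B_comega π τ γ G htr hG' _ hg hsG 0 hs]
        simp [cP, cQ]
      · rw [hc0 1 hp]; ring
end
end
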